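/- arXiv:2207.05576 — 2 statements merged into one kernel-verified Lean document; each statement's English description precedes it below -/
import Mathlib

section
/- For every integer k ≥ 1, the real number μ_k is algebraic of degree exactly 2^k, i.e., the minimal polynomial of μ_k over ℚ has degree 2^k. -/
/-- The sequence `μ_k`: `μ_1 = 1/√3` and `μ_{k+1} = 1/√(3 - 2 μ_k)`
(the value `μ_0 = 0` is a junk value making the recursion total). -/
noncomputable def mu : ℕ → ℝ
  | 0 => 0
  | k + 1 => 1 / Real.sqrt (3 - 2 * mu k)

open Polynomial

lemma mu_mem_Icc (k : ℕ) : mu k ∈ Set.Icc (0 : ℝ) 1 := by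
  induction k with
  | zero => simp [mu]
  | succ k ih =>
    have h : 1 ≤ Real.sqrt (3 - 2 * mu k) := Real.one_le_sqrt.2 (by linarith [ih.2])
    rw [mu]
    exact ⟨by positivity, (div_le_one (by linarith)).2 h⟩

lemma mu_succ_sq_mul (k : ℕ) : mu (k + 1) ^ 2 * (3 - 2 * mu k) = 1 := by
  have h : 0 < 3 - 2 * mu k := by linarith [(mu_mem_Icc k).2]
  rw [mu, div_pow, Real.sq_sqrt h.le]
  field_simp

lemma mu_succ_ne_zero (k : ℕ) : mu (k + 1) ≠ 0 := by
  intro h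
  simpa [h] using mu_succ_sq_mul k

/-- The second iterate of the homogeneous lift `(A, B) ↦ (3A² - B², 2A²)` of the rational map
`g(x) = (3x² - 1) / (2x²)`, which satisfies `g(μ_{k+1}) = μ_k`. -/
noncomputable def doubleStep (p : ℤ[X] × ℤ[X]) : ℤ[X] × ℤ[X] :=
  (3 * (3 * p.1 ^ 2 - p.2 ^ 2) ^ 2 - 4 * p.1 ^ 4, 2 * (3 * p.1 ^ 2 - p.2 ^ 2) ^ 2)

lemma exists_aeval_doubleStep_iterate {p : ℤ[X] × ℤ[X]} {x : ℕ → ℝ} {s : ℕ}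
    (h : ∀ i, ∃ c : ℝ, aeval (x (i + s)) p.1 = c * mu i ∧ aeval (x (i + s)) p.2 = c) (j i : ℕ) :
    ∃ c : ℝ, aeval (x (i + 2 * j + s)) (doubleStep^[j] p).1 = c * mu i ∧
      aeval (x (i + 2 * j + s)) (doubleStep^[j] p).2 = c := by
  induction j generalizing i with
  | zero => exact h i
  | succ j ih =>
    obtain ⟨c, h₁, h₂⟩ := ih (i + 2)
    rw [show i + 2 + 2 * j + s = i + 2 * (j + 1) + s by ring] at h₁ h₂
    have e₁ := mu_succ_sq_mul i
    have e₂ := mu_succ_sq_mul (i + 1)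
    have e₃ : 3 * (c * mu (i + 2)) ^ 2 - c ^ 2 = 2 * c ^ 2 * mu (i + 2) ^ 2 * mu (i + 1) := by
      linear_combination c ^ 2 * e₂
    rw [Function.iterate_succ_apply']
    refine ⟨_, ?_, rfl⟩
    simp only [doubleStep, map_sub, map_mul, map_pow, map_ofNat, h₁, h₂, e₃]
    linear_combination (4 * c ^ 4 * mu (i + 2) ^ 4) * e₁

/-- The congruences modulo `3` and degree bounds preserved by `doubleStep`. -/
structure IsPurePair (n : ℕ) (p : ℤ[X] × ℤ[X]) : Prop where
  natDegree_fst_le : p.1.natDegree ≤ n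
  natDegree_snd_le : p.2.natDegree ≤ n
  map_fst : p.1.map (Int.castRingHom (ZMod 3)) = -X ^ n
  map_snd : p.2.map (Int.castRingHom (ZMod 3)) = -1

lemma three_eq_zero_zmod_three_polynomial : (3 : (ZMod 3)[X]) = 0 := by
  exact_mod_cast CharP.cast_eq_zero (ZMod 3)[X] 3

lemma IsPurePair.doubleStep {n : ℕ} {p : ℤ[X] × ℤ[X]} (h : IsPurePair n p) :
    IsPurePair (4 * n) (doubleStep p) := by
  have h3 := three_eq_zero_zmod_three_polynomial
  have d₁ := h.natDegree_fst_le
  have d₂ := h.natDegree_snd_le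
  have d : (3 * p.1 ^ 2 - p.2 ^ 2).natDegree ≤ 2 * n := by
    refine (natDegree_sub_le_of_le ?_ (natDegree_pow_le_of_le 2 d₂)).trans (max_self _).le
    exact (natDegree_mul_le_of_le (natDegree_ofNat 3).le (natDegree_pow_le_of_le 2 d₁)).trans
      (by omega)
  have d' : ((3 * p.1 ^ 2 - p.2 ^ 2) ^ 2).natDegree ≤ 4 * n :=
    (natDegree_pow_le_of_le 2 d).trans (by omega)
  refine ⟨(natDegree_sub_le_of_le ?_ ?_).trans (max_self (4 * n)).le, ?_, ?_, ?_⟩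
  · exact (natDegree_mul_le_of_le (natDegree_ofNat 3).le d').trans (by omega)
  · exact (natDegree_mul_le_of_le (natDegree_ofNat 4).le (natDegree_pow_le_of_le 4 d₁)).trans
      (by omega)
  · exact (natDegree_mul_le_of_le (natDegree_ofNat 2).le d').trans (by omega)
  · simp only [_root_.doubleStep, Polynomial.map_sub, Polynomial.map_mul, Polynomial.map_pow,
      Polynomial.map_ofNat, h.map_fst, h.map_snd]
    linear_combination ((3 * (X ^ n) ^ 2 - 1) ^ 2 - (X ^ n) ^ 4) * h3
  · simp only [_root_.doubleStep, Polynomial.map_sub, Polynomial.map_mul, Polynomial.map_pow,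
      Polynomial.map_ofNat, h.map_fst, h.map_snd]
    linear_combination (1 + 2 * (X ^ n) ^ 2 * (3 * (X ^ n) ^ 2 - 2)) * h3

lemma IsPurePair.iterate {n : ℕ} {p : ℤ[X] × ℤ[X]} (h : IsPurePair n p) (j : ℕ) :
    IsPurePair (4 ^ j * n) (_root_.doubleStep^[j] p) := by
  induction j with
  | zero => simpa using h
  | succ j ih =>
    rw [Function.iterate_succ_apply', pow_succ', mul_assoc]
    exact ih.doubleStep

lemma IsPurePair.three_dvd_coeff {n i : ℕ} {p : ℤ[X] × ℤ[X]} (h : IsPurePair n p) (hi : i ≠ n) :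
    3 ∣ p.1.coeff i := by
  have := congrArg (coeff · i) h.map_fst
  simp only [coeff_map, coeff_neg, coeff_X_pow, if_neg hi, neg_zero, eq_intCast] at this
  exact (ZMod.intCast_zmod_eq_zero_iff_dvd _ 3).1 this

lemma IsPurePair.not_three_dvd_coeff {n : ℕ} {p : ℤ[X] × ℤ[X]} (h : IsPurePair n p) :
    ¬ 3 ∣ p.1.coeff n := by
  have := congrArg (coeff · n) h.map_fst
  simp only [coeff_map, coeff_neg, coeff_X_pow, if_true, eq_intCast] at this
  intro hd
  rw [(ZMod.intCast_zmod_eq_zero_iff_dvd _ 3).2 hd] at this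
  revert this
  decide

lemma IsPurePair.not_nine_dvd_doubleStep {n : ℕ} {p : ℤ[X] × ℤ[X]} (h : IsPurePair n p)
    (hn : n ≠ 0) : ¬ 9 ∣ (_root_.doubleStep p).1.coeff 0 := by
  obtain ⟨a, ha⟩ := h.three_dvd_coeff hn.symm
  have hb := congrArg (coeff · 0) h.map_snd
  simp only [coeff_map, coeff_neg, coeff_one_zero, eq_intCast] at hb
  obtain ⟨b, hb⟩ : 3 ∣ p.2.coeff 0 + 1 := by
    refine (ZMod.intCast_zmod_eq_zero_iff_dvd _ 3).1 ?_
    push_cast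
    rw [hb]
    ring
  replace hb : p.2.coeff 0 = 3 * b - 1 := by linarith
  rw [coeff_zero_eq_eval_zero] at ha hb ⊢
  simp only [_root_.doubleStep, eval_sub, eval_mul, eval_pow, eval_ofNat, ha, hb]
  rintro ⟨t, ht⟩
  ring_nf at ht
  omega

/-- Eisenstein's criterion over `ℚ`, without a primitivity assumption. -/
lemma irreducible_map_of_eisenstein {q : ℕ} (hq : q.Prime) {n : ℕ} (hn : n ≠ 0) {f : ℤ[X]}
    (hdeg : f.natDegree = n) (hlead : ¬ (q : ℤ) ∣ f.coeff n)
    (hcoeff : ∀ i < n, (q : ℤ) ∣ f.coeff i) (hzero : ¬ (q : ℤ) ^ 2 ∣ f.coeff 0) :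
    Irreducible (f.map (Int.castRingHom ℚ)) := by
  have hp : Prime (q : ℤ) := Nat.prime_iff_prime_int.1 hq
  have hc (i : ℕ) : f.coeff i = f.content * f.primPart.coeff i := by
    conv_lhs => rw [f.eq_C_content_mul_primPart, coeff_C_mul]
  have hqc : ¬ (q : ℤ) ∣ f.content := fun h => hlead (h.trans (content_dvd_coeff n))
  have hirr : Irreducible f.primPart := by
    refine IsEisensteinAt.irreducible (𝓟 := Ideal.span {(q : ℤ)}) ⟨?_, ?_, ?_⟩
      ((Ideal.span_singleton_prime hp.ne_zero).2 hp) f.isPrimitive_primPart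
      (by rw [natDegree_primPart]; omega)
    · rw [Ideal.mem_span_singleton, leadingCoeff, natDegree_primPart, hdeg]
      exact fun h => hlead (hc n ▸ h.mul_left _)
    · intro i hi
      rw [natDegree_primPart, hdeg] at hi
      rw [Ideal.mem_span_singleton]
      exact (hp.dvd_or_dvd (hc i ▸ hcoeff i hi)).resolve_left hqc
    · rw [Ideal.span_singleton_pow, Ideal.mem_span_singleton]
      exact fun h => hzero (hc 0 ▸ h.mul_left _)
  have hirrQ :=
    (IsPrimitive.Int.irreducible_iff_irreducible_map_cast f.isPrimitive_primPart).1 hirr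
  have hcont : (f.content : ℚ) ≠ 0 := by
    intro h
    exact hqc (by simp [Int.cast_eq_zero.1 h])
  rw [f.eq_C_content_mul_primPart, Polynomial.map_mul, map_C]
  exact (irreducible_isUnit_mul (isUnit_C.2 (isUnit_iff_ne_zero.2 hcont))).2 hirrQ

lemma IsPurePair.isAlgebraic_and_natDegree_minpoly {n : ℕ} {p : ℤ[X] × ℤ[X]}
    (h : IsPurePair n p) (hn : n ≠ 0) (h9 : ¬ 9 ∣ p.1.coeff 0) {x : ℝ} (hx : aeval x p.1 = 0) :
    IsAlgebraic ℚ x ∧ (minpoly ℚ x).natDegree = n := by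
  have hdeg : p.1.natDegree = n := natDegree_eq_of_le_of_coeff_ne_zero h.natDegree_fst_le
    fun h0 => h.not_three_dvd_coeff (h0 ▸ dvd_zero 3)
  have hirr := irreducible_map_of_eisenstein Nat.prime_three hn hdeg h.not_three_dvd_coeff
    (fun i hi => h.three_dvd_coeff hi.ne) (by norm_num; exact h9)
  have hx' : aeval x (p.1.map (Int.castRingHom ℚ)) = 0 := by
    rw [← algebraMap_int_eq, aeval_map_algebraMap, hx]
  refine ⟨⟨_, hirr.ne_zero, hx'⟩, ?_⟩
  rw [← minpoly.eq_of_irreducible hirr hx',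
    natDegree_mul_C (inv_ne_zero (leadingCoeff_ne_zero.2 hirr.ne_zero)),
    natDegree_map_eq_of_injective Int.cast_injective, hdeg]

lemma natDegree_minpoly_inv {K L : Type*} [Field K] [Field L] [Algebra K L] {x : L}
    (hx : IsAlgebraic K x) : (minpoly K x⁻¹).natDegree = (minpoly K x).natDegree := by
  rw [← IntermediateField.adjoin.finrank hx.isIntegral,
    ← IntermediateField.adjoin.finrank hx.inv.isIntegral]
  have key (y : L) : IntermediateField.adjoin K {y⁻¹} ≤ IntermediateField.adjoin K {y} :=
    IntermediateField.adjoin_simple_le_iff.2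
      (inv_mem (IntermediateField.mem_adjoin_simple_self K y))
  rw [le_antisymm (key x) (by simpa using key x⁻¹)]

/-- For every integer `k ≥ 1`, the real number `μ_k` is algebraic over `ℚ` and its
minimal polynomial over `ℚ` has degree exactly `2^k`. -/
theorem mu_algebraic_degree (k : ℕ) (hk : 1 ≤ k) :
    IsAlgebraic ℚ (mu k) ∧ (minpoly ℚ (mu k)).natDegree = 2 ^ k := by
  have h3 := three_eq_zero_zmod_three_polynomial
  obtain ⟨j, rfl | rfl⟩ := k.even_or_odd'
  · obtain ⟨j, rfl⟩ : ∃ i, j = i + 1 := ⟨j - 1, by omega⟩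
    have hpure : IsPurePair 1 ((-X, -1) : ℤ[X] × ℤ[X]) := ⟨by simp, by simp, by simp, by simp⟩
    obtain ⟨c, hc, -⟩ := exists_aeval_doubleStep_iterate (p := (-X, -1)) (x := mu) (s := 0)
      (fun i => ⟨-1, by simp, by simp⟩) (j + 1) 0
    have := (hpure.iterate (j + 1)).isAlgebraic_and_natDegree_minpoly (by positivity)
      (by
        rw [Function.iterate_succ_apply']
        exact (hpure.iterate j).not_nine_dvd_doubleStep (by positivity))
      (hc.trans (by simp [mu]))
    simpa [pow_mul] using this
  · have hpure : IsPurePair 2 ((3 - X ^ 2, 2) : ℤ[X] × ℤ[X]) := by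
      refine ⟨show (3 - X ^ 2 : ℤ[X]).natDegree ≤ 2 by compute_degree, by simp, ?_, ?_⟩
      · simp [h3]
      · simp only [Polynomial.map_ofNat]
        linear_combination h3
    obtain ⟨c, hc, -⟩ := exists_aeval_doubleStep_iterate (p := (3 - X ^ 2, 2))
      (x := fun i => (mu i)⁻¹) (s := 1)
      (fun i => ⟨2, by
        have := mu_succ_sq_mul i
        have := mu_succ_ne_zero i
        simp only [map_sub, map_pow, map_ofNat, aeval_X]
        field_simp
        linarith, map_ofNat _ 2⟩) j 0
    have := (hpure.iterate j).isAlgebraic_and_natDegree_minpoly (by positivity)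
      (by
        cases j with
        | zero => simp [coeff_X_pow]
        | succ j =>
          rw [Function.iterate_succ_apply']
          exact (hpure.iterate j).not_nine_dvd_doubleStep (by positivity))
      (hc.trans (by simp [mu]))
    rw [zero_add, natDegree_minpoly_inv (by simpa using this.1.inv)] at this
    exact ⟨by simpa using this.1.inv, by rw [this.2, pow_succ, pow_mul]; norm_num⟩
end

section
/- For every integer k ≥ 1: the coefficient c_{k+1,j} of X^j in p_{k+1} is zero for every odd j (p_{k+1} is an even polynomial), and for every integer j with 0 ≤ j ≤ 2^k one has c_{k+1,2j} ≡ c_{k,2^k − j} (mod 3). -/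
open Polynomial in
/-- `pp k` is the integer polynomial `p_{k+1}`: `pp 0 = p_1 = 3X² - 1`, and
`p_{k+2} = Σ_{i=0}^{2^{k+1}} c_{k+1,i} · (3X² - 1)^i · (2X²)^{2^{k+1} - i}`,
where `c_{k+1,i}` is the coefficient of `X^i` in `p_{k+1} = pp k`. -/
noncomputable def pp : ℕ → Polynomial ℤ
  | 0 => 3 * X ^ 2 - 1
  | k + 1 => ∑ i ∈ Finset.range (2 ^ (k + 1) + 1),
      C ((pp k).coeff i) * (3 * X ^ 2 - 1) ^ i * (2 * X ^ 2) ^ (2 ^ (k + 1) - i)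

open Polynomial in
/-- `pp (k + 1)` is a polynomial in `X ^ 2`. -/
lemma pp_succ_eq_expand (k : ℕ) :
    pp (k + 1) = expand ℤ 2 (∑ i ∈ Finset.range (2 ^ (k + 1) + 1),
      C ((pp k).coeff i) * (3 * X - 1) ^ i * (2 * X) ^ (2 ^ (k + 1) - i)) := by
  have h2 : expand ℤ 2 (2 : ℤ[X]) = 2 := map_ofNat _ 2
  have h3 : expand ℤ 2 (3 : ℤ[X]) = 3 := map_ofNat _ 3
  simp [pp, h2, h3]

open Polynomial in
/-- Modulo `3`, `pp (k + 1)` is the reversal of `pp k` evaluated at `X ^ 2`. -/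
lemma map_pp_succ_zmod_three (k : ℕ) :
    (pp (k + 1)).map (Int.castRingHom (ZMod 3)) =
      ∑ i ∈ Finset.range (2 ^ (k + 1) + 1),
        C ((pp k).coeff i : ZMod 3) * X ^ (2 * (2 ^ (k + 1) - i)) := by
  have h3 : (3 : (ZMod 3)[X]) = 0 := CharP.cast_eq_zero (ZMod 3)[X] 3
  have h2 : (2 : (ZMod 3)[X]) = -1 := by linear_combination h3
  have heven : Even (2 ^ (k + 1)) := even_two.pow_of_ne_zero k.succ_ne_zero
  simp only [pp, Polynomial.map_sum]
  refine Finset.sum_congr rfl fun i hi => ?_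
  have hi' : i ≤ 2 ^ (k + 1) := Nat.lt_succ_iff.mp (Finset.mem_range.mp hi)
  have hsign : (-1 : (ZMod 3)[X]) ^ i * (-1) ^ (2 ^ (k + 1) - i) = 1 := by
    rw [← pow_add, Nat.add_sub_cancel' hi', heven.neg_one_pow]
  simp only [Polynomial.map_mul, Polynomial.map_pow, Polynomial.map_sub, map_C, map_X,
    Polynomial.map_one, Polynomial.map_ofNat, eq_intCast (Int.castRingHom (ZMod 3)), h3, h2,
    zero_mul, zero_sub, mul_pow, ← pow_mul]
  linear_combination (C ((pp k).coeff i : ZMod 3) * X ^ (2 * (2 ^ (k + 1) - i))) * hsign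

/-- For every integer `k ≥ 1`: the coefficient `c_{k+1,j}` of `X^j` in `p_{k+1} = pp k`
vanishes for every odd `j` (`p_{k+1}` is even), and for every `0 ≤ j ≤ 2^k`,
`c_{k+1,2j} ≡ c_{k,2^k - j} (mod 3)` (here `c_{k,i}` is the coefficient of `X^i` in
`p_k = pp (k-1)`). -/
theorem pp_coeff_mod_three (k : ℕ) (hk : 1 ≤ k) :
    (∀ j : ℕ, Odd j → (pp k).coeff j = 0) ∧
    (∀ j : ℕ, j ≤ 2 ^ k →
      (pp k).coeff (2 * j) ≡ (pp (k - 1)).coeff (2 ^ k - j) [ZMOD 3]) := by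
  obtain ⟨k, rfl⟩ := Nat.exists_eq_succ_of_ne_zero (Nat.one_le_iff_ne_zero.mp hk)
  refine ⟨fun j hj => ?_, fun j hj => ?_⟩
  · rw [Nat.succ_eq_add_one, pp_succ_eq_expand, Polynomial.coeff_expand two_pos,
      if_neg hj.not_two_dvd_nat]
  · refine (ZMod.intCast_eq_intCast_iff _ _ 3).mp ?_
    rw [Nat.succ_eq_add_one, Nat.add_sub_cancel,
      ← eq_intCast (Int.castRingHom (ZMod 3)) ((pp (k + 1)).coeff (2 * j)),
      ← Polynomial.coeff_map, map_pp_succ_zmod_three, Polynomial.finsetSum_coeff,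
      Finset.sum_eq_single (2 ^ (k + 1) - j)]
    · rw [Nat.sub_sub_self hj, Polynomial.coeff_C_mul_X_pow, if_pos rfl]
    · intro i hi hne
      rw [Finset.mem_range] at hi
      rw [Polynomial.coeff_C_mul_X_pow, if_neg (by omega)]
    · intro h
      exact absurd (Finset.mem_range.mpr (by omega)) h
end
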